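/- arXiv:2605.01332 — 4 statements merged into one kernel-verified Lean document; each statement's English description precedes it below -/
import Mathlib

section
/- Let (W, S) be a Coxeter system and let w = s_{i_1} s_{i_2} ⋯ s_{i_r} be a reduced expression with r = ℓ(w) in which the simple reflections s_{i_1}, …, s_{i_r} are pairwise distinct (i.e., w is of Coxeter type). Then the map A ↦ w_A, from the power set of {1,…,r} ordered by inclusion to the Bruhat interval [e,w] = {u ∈ W : u ≤ w} ordered by the Bruhat order, is an order isomorphism. In particular, [e,w] is isomorphic as a poset to the Boolean lattice of rank ℓ(w). -/
/-- The Bruhat order on a Coxeter group, characterized by the subword property: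
`u ≤ w` iff every reduced word for `w` contains a subword that is a reduced word for `u`. -/
def CoxeterSystem.bruhatLE {B W : Type*} [Group W] {M : CoxeterMatrix B}
    (cs : CoxeterSystem M W) (u w : W) : Prop :=
  ∀ ω : List B, cs.IsReduced ω → cs.wordProd ω = w →
    ∃ ω' : List B, ω'.Sublist ω ∧ cs.IsReduced ω' ∧ cs.wordProd ω' = u

/-- Given a word `ω` and a set `A` of positions, the product of the letters of `ω`
at the positions in `A`, taken in increasing order. -/
def CoxeterSystem.subwordProd {B W : Type*} [Group W] {M : CoxeterMatrix B}
    (cs : CoxeterSystem M W) (ω : List B) (A : Finset (Fin ω.length)) : W :=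
  cs.wordProd ((A.sort (· ≤ ·)).map ω.get)

namespace CoxeterSystem

variable {B W : Type*} [Group W] {M : CoxeterMatrix B} (cs : CoxeterSystem M W)

theorem functionEnd_mul_apply {α : Type*} (f g : Function.End α) (x : α) :
    (f * g) x = f (g x) := rfl

open Classical in
/-- The action of the simple reflection `i` on `W × ZMod 2`: conjugation on the first coordinate,
flipping the second coordinate at the simple reflection itself. -/
noncomputable def signedConj (i : B) : Function.End (W × ZMod 2) :=
  fun p ↦ (cs.simple i * p.1 * cs.simple i, p.2 + if p.1 = cs.simple i then 1 else 0)

open Classical in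
theorem signedConj_mul_pow_apply (i j : B) (k : ℕ) (t : W) (e : ZMod 2) :
    ((cs.signedConj i * cs.signedConj j) ^ k : Function.End (W × ZMod 2)) (t, e) =
      ((cs.simple i * cs.simple j) ^ k * t * (cs.simple j * cs.simple i) ^ k,
        e + ∑ n ∈ Finset.range (2 * k),
          if t = (cs.simple j * cs.simple i) ^ n * cs.simple j then 1 else 0) := by
  induction k with
  | zero => simp [Function.End.one_def]
  | succ k ih =>
    have hinv : (cs.simple i * cs.simple j) ^ k = ((cs.simple j * cs.simple i) ^ k)⁻¹ := by
      rw [← inv_pow]; simp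
    have hconj : cs.simple j * ((cs.simple j * cs.simple i) ^ k)⁻¹ =
        (cs.simple j * cs.simple i) ^ k * cs.simple j := by
      rw [← hinv, mul_pow_mul]
    have key (z : W) : (cs.simple i * cs.simple j) ^ k * t * (cs.simple j * cs.simple i) ^ k = z ↔
        t = (cs.simple j * cs.simple i) ^ k * z * ((cs.simple j * cs.simple i) ^ k)⁻¹ := by
      rw [hinv]
      constructor
      · rintro rfl; group
      · rintro h; rw [h]; group
    have h1 : (cs.simple i * cs.simple j) ^ k * t * (cs.simple j * cs.simple i) ^ k =
        cs.simple j ↔ t = (cs.simple j * cs.simple i) ^ (2 * k) * cs.simple j := by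
      rw [key, mul_assoc, hconj, ← mul_assoc, ← pow_add, two_mul]
    have h2 : cs.simple j * ((cs.simple i * cs.simple j) ^ k * t *
        (cs.simple j * cs.simple i) ^ k) * cs.simple j = cs.simple i ↔
        t = (cs.simple j * cs.simple i) ^ (2 * k + 1) * cs.simple j := by
      have : ∀ x : W, cs.simple j * x * cs.simple j = cs.simple i ↔
          x = cs.simple j * cs.simple i * cs.simple j := by
        intro x
        constructor
        · intro h; rw [← h]; simp [mul_assoc]
        · rintro rfl; simp [mul_assoc]
      rw [this, key, mul_assoc, mul_assoc (_ * _) (cs.simple j), hconj]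
      rw [show 2 * k + 1 = k + (1 + k) by ring, pow_add, pow_add, pow_one]
      simp only [mul_assoc]
    rw [pow_succ', functionEnd_mul_apply, ih, functionEnd_mul_apply]
    simp only [signedConj, h1, h2, mul_add, mul_one,
      Finset.sum_range_succ, Prod.mk.injEq]
    constructor
    · rw [pow_succ' (cs.simple i * _), pow_succ (cs.simple j * _)]
      simp only [mul_assoc]
    · ring

theorem isLiftable_signedConj : M.IsLiftable cs.signedConj := by
  classical
  intro i j
  funext ⟨t, e⟩
  rw [signedConj_mul_pow_apply, two_mul, Finset.sum_range_add]
  simp only [pow_add, simple_mul_simple_pow, simple_mul_simple_pow', one_mul, mul_one]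
  rw [CharTwo.add_self_eq_zero, add_zero]
  rfl

/-- The homomorphism from `W` to the self-maps of `W × ZMod 2` extending `signedConj`. -/
noncomputable def signedConjHom : W →* Function.End (W × ZMod 2) :=
  cs.lift ⟨cs.signedConj, cs.isLiftable_signedConj⟩

theorem signedConjHom_simple (i : B) : cs.signedConjHom (cs.simple i) = cs.signedConj i :=
  cs.lift_apply_simple cs.isLiftable_signedConj i

open Classical in
theorem signedConjHom_wordProd_apply (ω : List B) (t : W) (e : ZMod 2) :
    cs.signedConjHom (cs.wordProd ω) (t, e) =
      (cs.wordProd ω * t * (cs.wordProd ω)⁻¹, e + (cs.rightInvSeq ω).count t) := by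
  induction ω with
  | nil => simp [Function.End.one_def]
  | cons i ω ih =>
    have h : cs.wordProd ω * t * (cs.wordProd ω)⁻¹ = cs.simple i ↔
        (cs.wordProd ω)⁻¹ * cs.simple i * cs.wordProd ω = t := by
      constructor
      · intro h; rw [← h]; group
      · rintro rfl; group
    rw [wordProd_cons, map_mul, signedConjHom_simple, functionEnd_mul_apply, ih]
    simp only [signedConj, rightInvSeq, List.count_cons, h, beq_iff_eq, Prod.mk.injEq]
    constructor
    · simp [mul_assoc]
    · push_cast
      ring

theorem simple_mem_rightInvSeq {ω : List B} {i : B} (h : cs.IsRightDescent (cs.wordProd ω) i) :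
    cs.simple i ∈ cs.rightInvSeq ω := by
  classical
  by_contra hω
  obtain ⟨τ, hτ, hτω⟩ := cs.exists_isReduced (cs.wordProd ω * cs.simple i)
  have hnot : cs.simple i ∉ cs.rightInvSeq τ := fun hmem ↦ by
    have := (cs.isRightInversion_of_mem_rightInvSeq hτ hmem).2
    rw [← hτω, simple_mul_simple_cancel_right] at this
    exact lt_asymm this h
  have hω' : cs.wordProd ω = cs.wordProd τ * cs.simple i := by
    rw [← hτω, simple_mul_simple_cancel_right]
  have h1 := cs.signedConjHom_wordProd_apply ω (cs.simple i) 0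
  rw [hω', map_mul, functionEnd_mul_apply, signedConjHom_simple] at h1
  simp only [signedConj] at h1
  rw [signedConjHom_wordProd_apply] at h1
  have h2 := congrArg Prod.snd h1
  simp [List.count_eq_zero_of_not_mem hω, List.count_eq_zero_of_not_mem hnot] at h2

/-- The exchange property. -/
theorem exists_eraseIdx_of_isLeftDescent {ω : List B} {i : B}
    (h : cs.IsLeftDescent (cs.wordProd ω) i) :
    ∃ j < ω.length, cs.simple i * cs.wordProd ω = cs.wordProd (ω.eraseIdx j) := by
  have hmem : cs.simple i ∈ cs.leftInvSeq ω := by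
    rw [← List.mem_reverse, ← rightInvSeq_reverse]
    apply cs.simple_mem_rightInvSeq
    rwa [wordProd_reverse, isRightDescent_inv_iff]
  obtain ⟨j, hj, hji⟩ := List.mem_iff_getElem.mp hmem
  refine ⟨j, by simpa using hj, ?_⟩
  rw [← getD_leftInvSeq_mul_wordProd, List.getD_eq_getElem _ 1 hj, hji]

/-- The deletion property. -/
theorem exists_isReduced_sublist (ω : List B) :
    ∃ ω' : List B, ω'.Sublist ω ∧ cs.IsReduced ω' ∧ cs.wordProd ω' = cs.wordProd ω := by
  induction ω with
  | nil => exact ⟨[], List.Sublist.refl _, by simp [IsReduced], rfl⟩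
  | cons i ω ih =>
    obtain ⟨τ, hsub, hred, hprod⟩ := ih
    by_cases h : cs.IsLeftDescent (cs.wordProd τ) i
    · obtain ⟨j, hj, hij⟩ := cs.exists_eraseIdx_of_isLeftDescent h
      refine ⟨τ.eraseIdx j, (List.eraseIdx_sublist ..).trans (hsub.trans (List.sublist_cons_self ..)),
        ?_, by rw [← hij, wordProd_cons, hprod]⟩
      rw [isLeftDescent_iff] at h
      rw [IsReduced, ← hij]
      have := List.length_eraseIdx_add_one hj
      have := hred.eq
      omega
    · refine ⟨i :: τ, hsub.cons_cons i, ?_, by rw [wordProd_cons, wordProd_cons, hprod]⟩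
      rw [not_isLeftDescent_iff] at h
      rw [IsReduced, wordProd_cons, h, hred.eq, List.length_cons]

theorem simple_mem_of_eq_wordProd {i : B} {ω : List B} (h : cs.simple i = cs.wordProd ω) :
    cs.simple i ∈ ω.map cs.simple := by
  obtain ⟨τ, hsub, hred, hprod⟩ := cs.exists_isReduced_sublist ω
  have hlen : τ.length = 1 := by rw [← hred.eq, hprod, ← h, length_simple]
  obtain ⟨k, rfl⟩ := List.length_eq_one_iff.mp hlen
  rw [h, ← hprod, wordProd_singleton]
  exact List.mem_map_of_mem (hsub.subset (List.mem_singleton_self k))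

theorem simple_mem_of_isLeftDescent {i : B} {ω : List B}
    (h : cs.IsLeftDescent (cs.wordProd ω) i) : cs.simple i ∈ ω.map cs.simple := by
  obtain ⟨j, -, hij⟩ := cs.exists_eraseIdx_of_isLeftDescent h
  have h1 : cs.simple i = cs.wordProd (ω.eraseIdx j ++ ω.reverse) := by
    rw [wordProd_append, wordProd_reverse, ← hij, mul_inv_cancel_right]
  have h2 := cs.simple_mem_of_eq_wordProd h1
  simp only [List.map_append, List.map_reverse, List.mem_append, List.mem_reverse] at h2
  exact h2.elim (fun h ↦ ((List.eraseIdx_sublist ω j).map cs.simple).subset h) id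

theorem isReduced_of_nodup {ω : List B} (h : (ω.map cs.simple).Nodup) : cs.IsReduced ω := by
  induction ω with
  | nil => simp [IsReduced]
  | cons i ω ih =>
    rw [List.map_cons, List.nodup_cons] at h
    have hi := (cs.not_isLeftDescent_iff).mp (mt cs.simple_mem_of_isLeftDescent h.1)
    rw [IsReduced, wordProd_cons, hi, (ih h.2).eq, List.length_cons]

theorem map_simple_subset {ω τ : List B} (hω : cs.IsReduced ω)
    (h : cs.wordProd ω = cs.wordProd τ) : ω.map cs.simple ⊆ τ.map cs.simple := by
  induction ω generalizing τ with
  | nil => simp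
  | cons i ω ih =>
    have hω' : cs.IsReduced ω := hω.drop 1
    have hi : cs.simple i * cs.wordProd τ = cs.wordProd ω := by
      rw [← h, wordProd_cons, simple_mul_simple_cancel_left]
    have hdesc : cs.IsLeftDescent (cs.wordProd τ) i := by
      rw [IsLeftDescent, hi, ← h, hω.eq, hω'.eq]
      simp
    obtain ⟨j, -, hij⟩ := cs.exists_eraseIdx_of_isLeftDescent hdesc
    rw [List.map_cons, List.cons_subset]
    exact ⟨cs.simple_mem_of_isLeftDescent hdesc,
      List.Subset.trans (ih hω' (hi.symm.trans hij))
        ((List.eraseIdx_sublist τ j).map cs.simple).subset⟩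

theorem perm_map_simple {ω τ : List B} (hω : (ω.map cs.simple).Nodup)
    (hτ : cs.IsReduced τ) (h : cs.wordProd ω = cs.wordProd τ) :
    (ω.map cs.simple).Perm (τ.map cs.simple) := by
  have hω' := cs.isReduced_of_nodup hω
  refine (List.subperm_of_subset hω (cs.map_simple_subset hω' h)).perm_of_length_le ?_
  rw [List.length_map, List.length_map, ← hω'.eq, ← hτ.eq, h]

theorem wordProd_append_of_nodup {α β τ : List B} {i : B}
    (hω : ((α ++ i :: β).map cs.simple).Nodup) (hτ : (τ.map cs.simple).Nodup)
    (hi : cs.simple i ∉ τ.map cs.simple)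
    (h : cs.simple i * cs.wordProd (α ++ i :: β) = cs.wordProd τ) :
    cs.wordProd (α ++ β) = cs.wordProd τ := by
  have hred := cs.isReduced_of_nodup hω
  have hτred := cs.isReduced_of_nodup hτ
  have hiτ : cs.wordProd (i :: τ) = cs.wordProd (α ++ i :: β) := by
    rw [wordProd_cons, ← h, simple_mul_simple_cancel_left]
  have hdesc : cs.IsLeftDescent (cs.wordProd (α ++ i :: β)) i := by
    have : cs.IsReduced (i :: τ) := cs.isReduced_of_nodup (List.nodup_cons.mpr ⟨hi, hτ⟩)
    rw [IsLeftDescent, h, ← hiτ, this.eq, hτred.eq]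
    simp
  obtain ⟨j, -, hij⟩ := cs.exists_eraseIdx_of_isLeftDescent hdesc
  rw [h] at hij
  have hsub := ((List.eraseIdx_sublist (α ++ i :: β) j).map cs.simple)
  have hnot : cs.simple i ∉ ((α ++ i :: β).eraseIdx j).map cs.simple := fun hmem ↦
    hi (cs.map_simple_subset (cs.isReduced_of_nodup (hω.sublist hsub)) hij.symm hmem)
  obtain hj | hj | hj := lt_trichotomy j α.length
  · rw [List.eraseIdx_append_of_lt_length hj] at hnot
    simp at hnot
  · subst hj
    rw [hij, List.eraseIdx_append_of_length_le le_rfl]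
    simp
  · obtain ⟨k, hk⟩ : ∃ k, j - α.length = k + 1 := ⟨j - α.length - 1, by omega⟩
    rw [List.eraseIdx_append_of_length_le hj.le, hk] at hnot
    simp at hnot

theorem commute_of_commute_wordProd {i : B} {ω : List B}
    (hω : ((i :: ω).map cs.simple).Nodup) (h : Commute (cs.simple i) (cs.wordProd ω)) :
    ∀ j ∈ ω, Commute (cs.simple i) (cs.simple j) := by
  induction ω with
  | nil => simp
  | cons a ω ih =>
    have hsub : ((i :: ω).map cs.simple).Nodup :=
      hω.sublist (((List.sublist_cons_self a ω).cons_cons i).map _)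
    have hperm : ((ω ++ [i]).map cs.simple).Perm ((i :: ω).map cs.simple) :=
      (List.perm_append_singleton i ω).map _
    have ha : cs.simple a ∉ (i :: ω).map cs.simple := by
      simp only [List.map_cons, List.nodup_cons, List.mem_cons, not_or] at hω ⊢
      exact ⟨fun h ↦ hω.1.1 h.symm, hω.2.1⟩
    have hprod : cs.simple a * cs.wordProd ([i] ++ a :: ω) = cs.wordProd (ω ++ [i]) := by
      have := h.eq
      rw [wordProd_cons] at this
      simp only [List.singleton_append, wordProd_append, wordProd_cons, wordProd_nil, mul_one]
      rw [this]
      simp [mul_assoc]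
    have hdel := cs.wordProd_append_of_nodup (α := [i]) hω (hperm.nodup_iff.mpr hsub)
      (fun hmem ↦ ha (hperm.subset hmem)) hprod
    have hcomm : Commute (cs.simple i) (cs.wordProd ω) := by
      simpa [wordProd_append, wordProd_cons, commute_iff_eq] using hdel
    have hia : Commute (cs.simple i) (cs.simple a) := by
      have := h.mul_right hcomm.inv_right
      rwa [wordProd_cons, mul_inv_cancel_right] at this
    rintro j hj
    obtain rfl | hj := List.mem_cons.mp hj
    · exact hia
    · exact ih hsub hcomm j hj

theorem commute_wordProd {x : W} {ω : List B} (h : ∀ j ∈ ω, Commute x (cs.simple j)) :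
    Commute x (cs.wordProd ω) := by
  induction ω with
  | nil => simp
  | cons a ω ih =>
    rw [wordProd_cons]
    exact (h a (by simp)).mul_right (ih fun j hj ↦ h j (by simp [hj]))

open Classical in
/-- Two words with distinct letters and the same product still have the same product after
restricting both to the same set of letters. -/
theorem wordProd_filter_eq {ω τ : List B} (hω : (ω.map cs.simple).Nodup)
    (hτ : (τ.map cs.simple).Nodup) (h : cs.wordProd ω = cs.wordProd τ) (P : Set W) :
    cs.wordProd (ω.filter (cs.simple · ∈ P)) = cs.wordProd (τ.filter (cs.simple · ∈ P)) := by
  induction ω generalizing τ with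
  | nil =>
    have := (cs.perm_map_simple hω (cs.isReduced_of_nodup hτ) h).symm
    simp only [List.map_nil, List.perm_nil, List.map_eq_nil_iff] at this
    rw [this]
  | cons i ω ih =>
    have hperm := cs.perm_map_simple hω (cs.isReduced_of_nodup hτ) h
    obtain ⟨b, hb, hbi⟩ := List.mem_map.mp (hperm.subset (by simp : cs.simple i ∈ _))
    obtain ⟨α, β, rfl⟩ := List.append_of_mem hb
    have hω' : cs.simple i ∉ ω.map cs.simple ∧ (ω.map cs.simple).Nodup := by
      simpa [List.nodup_cons] using hω
    have hb' : cs.simple b * cs.wordProd (α ++ b :: β) = cs.wordProd ω := by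
      rw [← h, hbi, wordProd_cons, simple_mul_simple_cancel_left]
    have hdel := cs.wordProd_append_of_nodup hτ hω'.2 (hbi ▸ hω'.1) hb'
    have hsub : ((α ++ β).map cs.simple).Nodup :=
      hτ.sublist (((List.sublist_cons_self b β).append_left α).map _)
    have hsub' : ((b :: α).map cs.simple).Nodup := by
      have : (b :: α).Subperm (α ++ b :: β) :=
        ((List.sublist_append_left (b :: α) β).subperm).trans List.perm_middle.symm.subperm
      obtain ⟨l, hl, hl'⟩ := this
      exact (hl.map cs.simple).nodup_iff.mp (hτ.sublist (hl'.map _))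
    have hcomm : Commute (cs.simple b) (cs.wordProd α) := by
      rw [← hb'] at hdel
      simp only [wordProd_append, wordProd_cons, ← mul_assoc, mul_left_inj] at hdel
      have : cs.wordProd α * cs.simple b = cs.simple b * cs.wordProd α := by
        nth_rw 1 [hdel]
        rw [simple_mul_simple_cancel_right]
      exact this.symm
    have hcomm' : Commute (cs.simple b) (cs.wordProd (α.filter (cs.simple · ∈ P))) :=
      cs.commute_wordProd fun j hj ↦
        cs.commute_of_commute_wordProd hsub' hcomm j (List.mem_of_mem_filter hj)
    have hih := ih hω'.2 hsub hdel.symm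
    rw [List.filter_append, wordProd_append] at hih
    rw [List.filter_append, wordProd_append]
    by_cases hP : cs.simple i ∈ P
    · rw [List.filter_cons_of_pos (by simpa), List.filter_cons_of_pos (by simpa [hbi]),
        wordProd_cons, wordProd_cons, hih, ← hbi, ← mul_assoc, ← mul_assoc, hcomm'.eq]
    · rw [List.filter_cons_of_neg (by simpa), List.filter_cons_of_neg (by simpa [hbi]), hih]

open Classical in
theorem exists_eq_filter_of_sublist {σ ω : List B} (hω : (ω.map cs.simple).Nodup) (h : σ.Sublist ω) :
    ∃ P : Set W, σ = ω.filter (cs.simple · ∈ P) := by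
  obtain ⟨P, hP⟩ : ∃ P : Set W, ∀ x, x ∈ P ↔ x ∈ σ.map cs.simple := ⟨{x | _}, fun _ ↦ Iff.rfl⟩
  have hsub : σ.Sublist (ω.filter (cs.simple · ∈ P)) := by
    have := h.filter (cs.simple · ∈ P)
    rwa [List.filter_eq_self.mpr fun a ha ↦ by simpa [hP] using ⟨a, ha, rfl⟩] at this
  refine ⟨P, hsub.eq_of_length_le ?_⟩
  have hnd := hω.sublist ((List.filter_sublist (l := ω) (p := (cs.simple · ∈ P))).map cs.simple)
  have hle := (List.subperm_of_subset (l₂ := σ.map cs.simple) hnd fun x hx ↦ by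
    obtain ⟨a, ha, rfl⟩ := List.mem_map.mp hx
    exact (hP _).mp (by simpa using (List.mem_filter.mp ha).2)).length_le
  simpa using hle

theorem bruhatLE_of_sublist {σ ω : List B} (hω : (ω.map cs.simple).Nodup) (h : σ.Sublist ω) :
    cs.bruhatLE (cs.wordProd σ) (cs.wordProd ω) := by
  classical
  intro τ hτ hτω
  have hnd : (τ.map cs.simple).Nodup :=
    (cs.perm_map_simple hω hτ hτω.symm).nodup_iff.mp hω
  obtain ⟨P, rfl⟩ := cs.exists_eq_filter_of_sublist hω h
  refine ⟨τ.filter (cs.simple · ∈ P), List.filter_sublist,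
    cs.isReduced_of_nodup (hnd.sublist (List.filter_sublist.map _)), ?_⟩
  exact (cs.wordProd_filter_eq hω hnd hτω.symm P).symm

theorem map_simple_subset_of_bruhatLE {σ ω : List B} (hσ : (σ.map cs.simple).Nodup)
    (hω : (ω.map cs.simple).Nodup) (h : cs.bruhatLE (cs.wordProd σ) (cs.wordProd ω)) :
    σ.map cs.simple ⊆ ω.map cs.simple := by
  obtain ⟨τ, hτ, -, hτσ⟩ := h ω (cs.isReduced_of_nodup hω) rfl
  exact List.Subset.trans (cs.map_simple_subset (cs.isReduced_of_nodup hσ) hτσ.symm)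
    (hτ.map _).subset

/-- The subword of `ω` at the positions in `A`. -/
def subword (ω : List B) (A : Finset (Fin ω.length)) : List B :=
  (A.sort (· ≤ ·)).map ω.get

theorem subword_sublist_subword (ω : List B) {A A' : Finset (Fin ω.length)} (h : A ⊆ A') :
    (subword ω A).Sublist (subword ω A') := by
  refine (List.sublist_of_subperm_of_sortedLE ?_ A.sortedLT_sort.sortedLE
    A'.sortedLT_sort.sortedLE).map _
  exact List.subperm_of_subset (A.sort_nodup _) fun x hx ↦ by simpa using h (by simpa using hx)

theorem subword_univ (ω : List B) : subword ω Finset.univ = ω := by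
  rw [subword, Fin.sort_univ, List.map_get_finRange]

theorem exists_subword_eq {σ ω : List B} (h : σ.Sublist ω) : ∃ A, subword ω A = σ := by
  obtain ⟨f, hf⟩ := List.sublist_iff_exists_fin_orderEmbedding_get_eq.mp h
  refine ⟨Finset.univ.map f.toEmbedding, ?_⟩
  have : (Finset.univ.map f.toEmbedding).sort (· ≤ ·) = (List.finRange σ.length).map f := by
    refine (Finset.sortedLT_sort _).eq_of_mem_iff
      (List.Pairwise.sortedLT ((List.sortedLT_finRange _).pairwise.map f fun _ _ h ↦ f.strictMono h)) ?_
    simp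
  rw [subword, this, List.map_map]
  conv_rhs => rw [← List.map_get_finRange σ]
  exact List.map_congr_left fun x _ ↦ (hf x).symm

theorem mem_of_simple_get_mem_subword {ω : List B} (hω : (ω.map cs.simple).Nodup)
    {A : Finset (Fin ω.length)} {a : Fin ω.length}
    (h : cs.simple (ω.get a) ∈ (subword ω A).map cs.simple) : a ∈ A := by
  simp only [subword, List.map_map, List.mem_map, Finset.mem_sort, Function.comp_apply] at h
  obtain ⟨b, hb, hba⟩ := h
  have : b = a := by
    have := (hω.getElem_inj_iff (i := b) (j := a) (hi := by simp) (hj := by simp)).mp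
      (by simpa using hba)
    exact Fin.ext this
  exact this ▸ hb

end CoxeterSystem

/-- If `w = s_{i_1} ⋯ s_{i_r}` is a reduced expression with pairwise distinct
simple reflections (i.e. `w` is of Coxeter type), then `A ↦ w_A` is an order isomorphism from
the power set of `{1, …, r}` ordered by inclusion onto the Bruhat interval `[e, w]` ordered by
the Bruhat order. In particular `[e, w]` is a Boolean lattice of rank `ℓ(w)`. -/
theorem boolean_interval_of_coxeter_type {B W : Type*} [Group W] {M : CoxeterMatrix B}
    (cs : CoxeterSystem M W) (w : W) (ω : List B)
    (hred : cs.IsReduced ω) (hprod : cs.wordProd ω = w)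
    (hdist : (ω.map cs.simple).Nodup) :
    (∀ A : Finset (Fin ω.length), cs.bruhatLE (cs.subwordProd ω A) w) ∧
    (∀ A A' : Finset (Fin ω.length),
      A ⊆ A' ↔ cs.bruhatLE (cs.subwordProd ω A) (cs.subwordProd ω A')) ∧
    (∀ u : W, cs.bruhatLE u w → ∃! A : Finset (Fin ω.length), cs.subwordProd ω A = u) := by
  have hsub (A : Finset (Fin ω.length)) : (CoxeterSystem.subword ω A).Sublist ω := by
    simpa only [CoxeterSystem.subword_univ] using CoxeterSystem.subword_sublist_subword ω (Finset.subset_univ A)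
  have hnd (A : Finset (Fin ω.length)) : ((CoxeterSystem.subword ω A).map cs.simple).Nodup :=
    hdist.sublist ((hsub A).map _)
  have hmono {A A' : Finset (Fin ω.length)}
      (h : (CoxeterSystem.subword ω A).map cs.simple ⊆ (CoxeterSystem.subword ω A').map cs.simple) : A ⊆ A' := fun a ha ↦
    cs.mem_of_simple_get_mem_subword hdist (h (by
      simp only [CoxeterSystem.subword, List.map_map, List.mem_map, Finset.mem_sort]
      exact ⟨a, ha, rfl⟩))
  refine ⟨fun A ↦ ?_, fun A A' ↦ ⟨fun h ↦ ?_, fun h ↦ ?_⟩, fun u hu ↦ ?_⟩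
  · rw [← hprod]
    exact cs.bruhatLE_of_sublist hdist (hsub A)
  · exact cs.bruhatLE_of_sublist (hnd A') (CoxeterSystem.subword_sublist_subword ω h)
  · exact hmono (cs.map_simple_subset_of_bruhatLE (hnd A) (hnd A') h)
  · obtain ⟨σ, hσ, -, rfl⟩ := hu ω hred hprod
    obtain ⟨A, rfl⟩ := CoxeterSystem.exists_subword_eq hσ
    refine ⟨A, rfl, fun A' h ↦ ?_⟩
    have hperm := cs.perm_map_simple (hnd A') (cs.isReduced_of_nodup (hnd A)) h
    exact (hmono hperm.subset).antisymm (hmono hperm.symm.subset)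
end

section
/- Let (W, S) be a Coxeter system and let w ∈ W with ℓ(w) = r. If the Bruhat interval [e,w] = {u ∈ W : u ≤ w} is order-isomorphic to the Boolean lattice of rank r (equivalently, has cardinality 2^r), then in every reduced expression w = s_{i_1} ⋯ s_{i_r} the simple reflections s_{i_1}, …, s_{i_r} are pairwise distinct; that is, w is of Coxeter type. -/
/-- The values of all subwords of a word, listed by subsets of positions, can be pairwise distinct
only if the letters of the word are. -/
theorem CoxeterSystem.nodup_map_simple_of_nodup_sublists {B W : Type*} [Group W]
    {M : CoxeterMatrix B} (cs : CoxeterSystem M W) {ω : List B}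
    (h : (ω.sublists.map cs.wordProd).Nodup) : (ω.map cs.simple).Nodup := by
  have hsub := (List.map_pure_sublist_sublists ω).map cs.wordProd
  have heq : (ω.map pure).map cs.wordProd = ω.map cs.simple := by
    rw [List.map_map]
    exact List.map_congr_left fun i _ => cs.wordProd_singleton i
  exact heq ▸ h.sublist hsub

/-- If `ℓ(w) = r` and the Bruhat interval `[e, w]` is order-isomorphic to the
Boolean lattice of rank `r`, then in every reduced expression for `w` the simple reflections
are pairwise distinct; that is, `w` is of Coxeter type. -/
theorem coxeter_type_of_boolean_interval {B W : Type*} [Group W] {M : CoxeterMatrix B}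
    (cs : CoxeterSystem M W) (w : W) (r : ℕ) (hr : cs.length w = r)
    (h : ∃ e : {u : W // cs.bruhatLE u w} ≃ Finset (Fin r),
      ∀ a b : {u : W // cs.bruhatLE u w}, cs.bruhatLE a.1 b.1 ↔ e a ⊆ e b) :
    ∀ ω : List B, cs.IsReduced ω → cs.wordProd ω = w → (ω.map cs.simple).Nodup := by
  classical
  intro ω hω hw
  obtain ⟨e, -⟩ := h
  have hlen : ω.length = r := by rw [← hω.eq, hw, hr]
  apply cs.nodup_map_simple_of_nodup_sublists
  rw [← Multiset.coe_nodup, ← Multiset.toFinset_card_eq_card_iff_nodup]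
  refine le_antisymm (Multiset.toFinset_card_le _) ?_
  have hcard : {u : W | cs.bruhatLE u w}.ncard = 2 ^ r := by
    rw [← Nat.card_coe_set_eq]
    exact (Nat.card_congr e).trans (by simp)
  have hle := Set.ncard_le_ncard (s := {u : W | cs.bruhatLE u w})
    (t := ((ω.sublists.map cs.wordProd : Multiset W).toFinset : Set W))
    (fun u hu => by
      obtain ⟨ω', hsub, -, hu'⟩ := hu ω hω hw
      simpa using ⟨ω', hsub, hu'⟩) (Finset.finite_toSet _)
  rw [Set.ncard_coe_finset] at hle
  simpa [hlen, ← hcard] using hle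
end

section
/- Let (W, S) be a Coxeter system and let w = s_{i_1} ⋯ s_{i_r} be a reduced expression in which the simple reflections s_{i_1}, …, s_{i_r} are pairwise distinct. Then for every u ∈ W with u ≤ w in Bruhat order there exists a unique subset A ⊆ {1,…,r} such that u = w_A. -/
namespace CoxeterMatrix

open Module Polynomial.Chebyshev Real

variable {B : Type*} (M : CoxeterMatrix B)

/-- The simple coroot of `i`: the functional sending the simple root of `j` to `-2 cos (π / M i j)`.
If `M i j = 0` the value is `-2`. -/
noncomputable def simpleCoroot (i : B) : Dual ℝ (B →₀ ℝ) :=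
  Finsupp.linearCombination ℝ fun j ↦ -2 * cos (π / M i j)

lemma simpleCoroot_single (i j : B) :
    M.simpleCoroot i (Finsupp.single j 1) = -2 * cos (π / M i j) := by
  simp [simpleCoroot]

lemma simpleCoroot_single_self (i : B) : M.simpleCoroot i (Finsupp.single i 1) = 2 := by
  simp [simpleCoroot_single]

/-- The reflection by which the simple generator `i` acts in the geometric representation. -/
noncomputable def simpleReflection (i : B) : (B →₀ ℝ) ≃ₗ[ℝ] (B →₀ ℝ) :=
  Module.reflection (M.simpleCoroot_single_self i)

lemma simpleReflection_apply (i : B) (v : B →₀ ℝ) :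
    M.simpleReflection i v = v - M.simpleCoroot i v • Finsupp.single i 1 :=
  Module.reflection_apply _ _

lemma simpleReflection_apply_of_ne {i j : B} (h : i ≠ j) (v : B →₀ ℝ) :
    M.simpleReflection i v j = v j := by
  simp [simpleReflection_apply, h]

lemma simpleReflection_single_self (i : B) :
    M.simpleReflection i (Finsupp.single i 1) = -Finsupp.single i 1 :=
  Module.reflection_apply_self _

lemma isLiftable_simpleReflection : M.IsLiftable M.simpleReflection := by
  intro i j
  ext1 z
  obtain rfl | hij := eq_or_ne i j
  · rw [M.diagonal, pow_one, LinearEquiv.mul_apply, LinearEquiv.coe_one, id]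
    exact Module.involutive_reflection (M.simpleCoroot_single_self i) z
  have hm1 : M i j ≠ 1 := M.off_diagonal i j hij
  obtain h2 | h2 := eq_or_ne (M i j) 2
  · have hc : cos (π / (M i j : ℝ)) = 0 := by rw [h2]; simp
    have hfj : M.simpleCoroot i (Finsupp.single j 1) = 0 := by simp [simpleCoroot_single, hc]
    have hgi : M.simpleCoroot j (Finsupp.single i 1) = 0 := by
      rw [simpleCoroot_single, M.symmetric j i, hc, mul_zero]
    rw [h2, pow_two]
    simp only [LinearEquiv.mul_apply, simpleReflection_apply, map_sub, map_smul, hfj, hgi,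
      simpleCoroot_single_self, LinearEquiv.coe_one, id]
    module
  obtain h0 | h0 := eq_or_ne (M i j) 0
  · rw [h0, pow_zero]
  unfold simpleReflection
  generalize hm : M i j = m at *
  have hm3 : 3 ≤ m := by lia
  have hmR : (3 : ℝ) ≤ m := by exact_mod_cast hm3
  have hsin : sin (2 * π / m) ≠ 0 := by
    refine (sin_pos_of_pos_of_lt_pi (by positivity) ?_).ne'
    rw [div_lt_iff₀ (by positivity)]
    nlinarith [pi_pos]
  have ht : M.simpleCoroot i (Finsupp.single j 1) * M.simpleCoroot j (Finsupp.single i 1) - 2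
      = 2 * cos (2 * π / m) := by
    rw [simpleCoroot_single, simpleCoroot_single, M.symmetric j i, hm, mul_div_assoc, cos_two_mul]
    ring
  rw [Module.reflection_mul_reflection_pow_apply _ _ m z _ rfl]
  have hS (n : ℤ) := S_two_mul_real_cos (2 * π / m) n
  rw [← ht] at hS
  generalize M.simpleCoroot i (Finsupp.single j 1) * M.simpleCoroot j (Finsupp.single i 1) - 2 = t
    at *
  obtain ⟨k, rfl | rfl⟩ := m.even_or_odd'
  · have hk : (S ℝ ((k : ℤ) - 1)).eval t = 0 := by
      refine (mul_eq_zero_iff_right hsin).1 ?_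
      rw [hS, ← sin_pi]
      congr 1
      have : (k : ℝ) ≠ 0 := by norm_cast; lia
      push_cast
      field_simp
      ring
    rw [show (((2 * k : ℕ) : ℤ) - 2) / 2 = k - 1 by lia,
      show (((2 * k : ℕ) : ℤ) - 1) / 2 = k - 1 by lia, hk]
    simp
  · have hk : (S ℝ (k : ℤ)).eval t + (S ℝ ((k : ℤ) - 1)).eval t = 0 := by
      refine (mul_eq_zero_iff_right hsin).1 ?_
      rw [add_mul, hS, hS]
      have h : ((k : ℤ) + 1 : ℝ) * (2 * π / (2 * k + 1 : ℕ)) =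
          2 * π - (((k : ℤ) - 1 : ℤ) + 1) * (2 * π / (2 * k + 1 : ℕ)) := by
        have : (2 * k + 1 : ℝ) ≠ 0 := by positivity
        push_cast
        field_simp
        ring
      rw [h, sin_two_pi_sub]
      ring
    rw [show (((2 * k + 1 : ℕ) : ℤ) - 1) / 2 = k by lia,
      show (((2 * k + 1 : ℕ) : ℤ) - 3) / 2 = k - 1 by lia,
      show (((2 * k + 1 : ℕ) : ℤ) - 2) / 2 = k - 1 by lia,
      show (((2 * k + 1 : ℕ) : ℤ)) / 2 = k by lia, hk]
    simp

end CoxeterMatrix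

namespace CoxeterSystem

variable {B W : Type*} [Group W] {M : CoxeterMatrix B} (cs : CoxeterSystem M W)

/-- The geometric representation of a Coxeter group. -/
noncomputable def geometricRep : W →* ((B →₀ ℝ) ≃ₗ[ℝ] (B →₀ ℝ)) :=
  cs.lift ⟨M.simpleReflection, M.isLiftable_simpleReflection⟩

lemma geometricRep_simple (i : B) : cs.geometricRep (cs.simple i) = M.simpleReflection i :=
  cs.lift_apply_simple M.isLiftable_simpleReflection i

lemma geometricRep_wordProd_apply_of_notMem {ω : List B} {b : B} (hb : b ∉ ω) (v : B →₀ ℝ) :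
    cs.geometricRep (cs.wordProd ω) v b = v b := by
  induction ω with
  | nil => simp
  | cons i ω ih =>
    rw [List.mem_cons, not_or] at hb
    rw [wordProd_cons, map_mul, LinearEquiv.mul_apply, geometricRep_simple,
      M.simpleReflection_apply_of_ne (Ne.symm hb.1), ih hb.2]

/-- A simple reflection does not lie in the parabolic subgroup generated by the others. -/
lemma simple_ne_wordProd_of_notMem {ω : List B} {b : B} (hb : b ∉ ω) :
    cs.simple b ≠ cs.wordProd ω := by
  intro h
  have key := cs.geometricRep_wordProd_apply_of_notMem hb (Finsupp.single b 1)
  rw [← h, geometricRep_simple, M.simpleReflection_single_self] at key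
  norm_num at key

lemma wordProd_ne_simple_mul_wordProd {ω₁ ω₂ : List B} {b : B} (h₁ : b ∉ ω₁) (h₂ : b ∉ ω₂) :
    cs.wordProd ω₁ ≠ cs.simple b * cs.wordProd ω₂ := by
  intro h
  refine cs.simple_ne_wordProd_of_notMem (ω := ω₁ ++ ω₂.reverse) (b := b) (by simp [h₁, h₂]) ?_
  rw [wordProd_append, wordProd_reverse, h, mul_inv_cancel_right]

/-- Subwords of a word with distinct letters are determined by their products. -/
lemma eq_of_sublist_of_wordProd_eq {ω : List B} (hω : ω.Nodup) {ω₁ ω₂ : List B}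
    (h₁ : ω₁.Sublist ω) (h₂ : ω₂.Sublist ω) (h : cs.wordProd ω₁ = cs.wordProd ω₂) :
    ω₁ = ω₂ := by
  induction ω generalizing ω₁ ω₂ with
  | nil => rw [List.sublist_nil.1 h₁, List.sublist_nil.1 h₂]
  | cons b ω ih =>
    obtain ⟨hb, hω⟩ := List.nodup_cons.1 hω
    have hmem {ω' : List B} (h' : ω'.Sublist ω) : b ∉ ω' := fun hb' ↦ hb (h'.subset hb')
    obtain h₁ | ⟨ω₁, rfl, h₁'⟩ := List.sublist_cons_iff.1 h₁ <;>
      obtain h₂ | ⟨ω₂, rfl, h₂'⟩ := List.sublist_cons_iff.1 h₂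
    · exact ih hω h₁ h₂ h
    · rw [wordProd_cons] at h
      exact (cs.wordProd_ne_simple_mul_wordProd (hmem h₁) (hmem h₂') h).elim
    · rw [wordProd_cons] at h
      exact (cs.wordProd_ne_simple_mul_wordProd (hmem h₂) (hmem h₁') h.symm).elim
    · rw [wordProd_cons, wordProd_cons, mul_right_inj] at h
      rw [ih hω h₁' h₂' h]

lemma subwordProd_injective {ω : List B} (hω : ω.Nodup) :
    Function.Injective (cs.subwordProd ω) := by
  intro A A' h
  have hsub (A : Finset (Fin ω.length)) : ((A.sort (· ≤ ·)).map ω.get).Sublist ω :=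
    List.map_getElem_sublist A.sortedLT_sort.pairwise
  have hsort := List.map_injective_iff.2 (List.nodup_iff_injective_get.1 hω)
    (cs.eq_of_sublist_of_wordProd_eq hω (hsub A) (hsub A') h)
  rw [← A.sort_toFinset (· ≤ ·), hsort, A'.sort_toFinset]

lemma exists_subwordProd_eq_of_sublist {ω ω' : List B} (h : ω'.Sublist ω) :
    ∃ A, cs.subwordProd ω A = cs.wordProd ω' := by
  obtain ⟨is, rfl, his⟩ := List.sublist_eq_map_getElem h
  refine ⟨is.toFinset, ?_⟩
  rw [subwordProd, (List.toFinset_sort (· ≤ ·) (his.imp ne_of_lt)).2 (his.imp le_of_lt)]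
  rfl

end CoxeterSystem

/-- If `w = s_{i_1} ⋯ s_{i_r}` is a reduced expression with pairwise distinct
simple reflections, then every `u ≤ w` in Bruhat order equals `w_A` for a unique subset
`A ⊆ {1, …, r}`. -/
theorem existsUnique_subset_of_le_coxeter_type {B W : Type*} [Group W] {M : CoxeterMatrix B}
    (cs : CoxeterSystem M W) (ω : List B) (hred : cs.IsReduced ω)
    (hdist : (ω.map cs.simple).Nodup) :
    ∀ u : W, cs.bruhatLE u (cs.wordProd ω) →
      ∃! A : Finset (Fin ω.length), cs.subwordProd ω A = u := by
  intro u hu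
  obtain ⟨ω', hsub, -, rfl⟩ := hu ω hred rfl
  obtain ⟨A, hA⟩ := cs.exists_subwordProd_eq_of_sublist hsub
  exact ⟨A, hA, fun A' hA' ↦ cs.subwordProd_injective (hdist.of_map _) (hA'.trans hA.symm)⟩
end

section
/- Let (W, S) be a Coxeter system, S_P ⊆ S a subset, and let w = s_{i_1} ⋯ s_{i_r} be a reduced expression in which the simple reflections s_{i_1}, …, s_{i_r} are pairwise distinct. Define the family of feasible sets F = {A ⊆ {1,…,r} : w_A ∈ W^P}. Then ∅ ∈ F, and for all A, B ∈ F with B ⊄ A, if x is the largest element of B \ A (in the usual order on integers), then A ∪ {x} ∈ F. In other words, ({1,…,r}, F) equipped with the reversed total order is a supersolvable antimatroid in the sense of Armstrong. -/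
/-- The set `W^P` of minimal length coset representatives attached to a subset `S_P` of the
simple reflections: `W^P = {v ∈ W : ℓ(v s) > ℓ(v) for every s ∈ S_P}`. -/
def CoxeterSystem.minCosetReps {B W : Type*} [Group W] {M : CoxeterMatrix B}
    (cs : CoxeterSystem M W) (SP : Set B) : Set W :=
  {v | ∀ i ∈ SP, cs.length v < cs.length (v * cs.simple i)}

open Module Polynomial.Chebyshev in
/-- Two reflections `x ↦ x - f(x) • v` and `x ↦ x - g(x) • w` with `f w = g v = -2 cos (π / m)`
satisfy the braid relation of order `m`. -/
theorem Module.reflection_mul_reflection_pow_eq_one_of_cos {V : Type*} [AddCommGroup V]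
    [Module ℝ V] {v w : V} {f g : Dual ℝ V} (hf : f v = 2) (hg : g w = 2) {m : ℕ} (hm : 2 ≤ m)
    (hfw : f w = -2 * Real.cos (Real.pi / m)) (hgv : g v = -2 * Real.cos (Real.pi / m)) :
    (reflection hf * reflection hg) ^ m = 1 := by
  obtain rfl | hm : m = 2 ∨ 3 ≤ m := by omega
  · simp only [Nat.cast_ofNat, Real.cos_pi_div_two, mul_zero] at hfw hgv
    ext z
    simp [pow_two, reflection_apply, hf, hg, hfw, hgv]
    module
  set θ := Real.pi / m with hθ
  have hm' : (0 : ℝ) < m := by positivity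
  have hmθ : m * θ = Real.pi := by rw [hθ]; field_simp
  have hsin : Real.sin (2 * θ) ≠ 0 := by
    refine (Real.sin_pos_of_pos_of_lt_pi (by positivity) ?_).ne'
    have : (3 : ℝ) ≤ m := by exact_mod_cast hm
    have : 0 < θ := by positivity
    nlinarith
  have ht : 2 * Real.cos (2 * θ) = f w * g v - 2 := by
    rw [hfw, hgv, Real.cos_two_mul]; ring
  have hS (k : ℤ) : (S ℝ k).eval (2 * Real.cos (2 * θ)) * Real.sin (2 * θ) =
      Real.sin ((k + 1) * (2 * θ)) := by
    rw [← U_real_cos, ← S_comp_two_mul_X]; simp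
  ext z
  rw [reflection_mul_reflection_pow_apply hf hg m z _ ht]
  obtain ⟨k, rfl | rfl⟩ := m.even_or_odd'
  · have h1 : (((2 * k : ℕ) : ℤ) - 2) / 2 = k - 1 := by omega
    have h2 : (((2 * k : ℕ) : ℤ) - 1) / 2 = k - 1 := by omega
    have h0 : (S ℝ ((k : ℤ) - 1)).eval (2 * Real.cos (2 * θ)) = 0 := by
      refine (mul_eq_zero.1 ?_).resolve_right hsin
      rw [hS, ← Real.sin_pi, ← hmθ]
      push_cast
      ring_nf
    rw [h1, h2, h0]
    simp
  · have h1 : (((2 * k + 1 : ℕ) : ℤ) - 2) / 2 = k - 1 := by omega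
    have h2 : (((2 * k + 1 : ℕ) : ℤ) - 1) / 2 = k := by omega
    have h3 : (((2 * k + 1 : ℕ) : ℤ) - 3) / 2 = k - 1 := by omega
    have h4 : ((2 * k + 1 : ℕ) : ℤ) / 2 = k := by omega
    have h0 : (S ℝ (k : ℤ)).eval (2 * Real.cos (2 * θ)) +
        (S ℝ ((k : ℤ) - 1)).eval (2 * Real.cos (2 * θ)) = 0 := by
      refine (mul_eq_zero.1 ?_).resolve_right hsin
      have e1 : (((k : ℤ) : ℝ) + 1) * (2 * θ) = Real.pi + θ := by
        rw [← hmθ]; push_cast; ring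
      have e2 : ((((k : ℤ) - 1 : ℤ) : ℝ) + 1) * (2 * θ) = Real.pi - θ := by
        rw [← hmθ]; push_cast; ring
      rw [add_mul, hS, hS, e1, e2, Real.sin_pi_sub, add_comm Real.pi, Real.sin_add_pi]
      ring
    rw [h1, h2, h3, h4, h0]
    simp

namespace CoxeterMatrix

variable {B : Type*} (M : CoxeterMatrix B)

/-- The underlying space of an extension of the geometric representation in which both the simple
roots and the simple coroots are linearly independent. -/
abbrev RootSpace (B : Type*) : Type _ := (B →₀ ℝ) × (B → ℝ)

/-- The simple root attached to `i`. -/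
noncomputable def root (i : B) : RootSpace B := (Finsupp.single i 1, 0)

open Classical in
/-- The vector dual to the simple coroot attached to `i`. -/
noncomputable def coweight (i : B) : RootSpace B := (0, Pi.single i 1)

/-- The simple coroot attached to `i`. -/
noncomputable def coroot (i : B) : Module.Dual ℝ (RootSpace B) :=
  (Finsupp.linearCombination ℝ fun j ↦ -2 * Real.cos (Real.pi / M i j)) ∘ₗ
    LinearMap.fst ℝ (B →₀ ℝ) (B → ℝ) + LinearMap.proj i ∘ₗ LinearMap.snd ℝ (B →₀ ℝ) (B → ℝ)

theorem coroot_root (i j : B) : M.coroot i (root j) = -2 * Real.cos (Real.pi / M i j) := by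
  simp [coroot, root]

theorem coroot_root_self (i : B) : M.coroot i (root i) = 2 := by
  simp [coroot_root]

theorem coroot_coweight_self (i : B) : M.coroot i (coweight i) = 1 := by
  simp [coroot, coweight]

theorem coroot_coweight_of_ne {i j : B} (h : i ≠ j) : M.coroot i (coweight j) = 0 := by
  simp [coroot, coweight, h]

theorem eq_two_of_coroot_root_eq_zero {i j : B} (hij : i ≠ j) (h : M.coroot i (root j) = 0) :
    M i j = 2 := by
  have h1 := M.off_diagonal i j hij
  obtain h0 | h2 | h3 : M i j = 0 ∨ M i j = 2 ∨ 3 ≤ M i j := by omega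
  · simp [coroot_root, h0] at h
  · exact h2
  · have h3' : (3 : ℝ) ≤ M i j := by exact_mod_cast h3
    have : 0 < Real.cos (Real.pi / M i j) := by
      have := Real.pi_pos
      refine Real.cos_pos_of_mem_Ioo ⟨?_, ?_⟩
      · have : 0 < Real.pi / M i j := by positivity
        linarith
      · exact div_lt_div_of_pos_left Real.pi_pos two_pos (by linarith)
    rw [coroot_root] at h
    linarith

theorem isLiftable_reflection :
    M.IsLiftable fun i ↦ Module.reflection (M.coroot_root_self i) := by
  intro i j
  by_cases hij : i = j
  · subst hij
    ext1 z
    simp [Module.involutive_reflection (M.coroot_root_self i) z]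
  have h1 := M.off_diagonal i j hij
  obtain h0 | h2 : M i j = 0 ∨ 2 ≤ M i j := by omega
  · rw [h0, pow_zero]
  · exact Module.reflection_mul_reflection_pow_eq_one_of_cos _ _ h2 (M.coroot_root i j)
      (by rw [coroot_root, M.symmetric j i])

end CoxeterMatrix

namespace CoxeterSystem

open CoxeterMatrix

variable {B W : Type*} [Group W] {M : CoxeterMatrix B} (cs : CoxeterSystem M W)

/-- The representation of `W` on `RootSpace B` extending the geometric representation. -/
noncomputable def rootRep : W →* (RootSpace B ≃ₗ[ℝ] RootSpace B) :=
  cs.lift ⟨_, M.isLiftable_reflection⟩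

theorem rootRep_simple_apply (i : B) (x : RootSpace B) :
    cs.rootRep (cs.simple i) x = x - M.coroot i x • root i := by
  rw [rootRep, lift_apply_simple, Module.reflection_apply]

theorem rootRep_wordProd_cons_apply (i : B) (ω : List B) (x : RootSpace B) :
    cs.rootRep (cs.wordProd (i :: ω)) x =
      cs.rootRep (cs.simple i) (cs.rootRep (cs.wordProd ω) x) := by
  rw [wordProd_cons, map_mul, LinearEquiv.mul_apply]

theorem rootRep_wordProd_apply_fst_of_notMem {ω : List B} {k : B} (h : k ∉ ω)
    (x : RootSpace B) : (cs.rootRep (cs.wordProd ω) x).1 k = x.1 k := by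
  induction ω with
  | nil => simp
  | cons i ω ih =>
    simp only [List.mem_cons, not_or] at h
    rw [rootRep_wordProd_cons_apply, rootRep_simple_apply, ← ih h.2]
    simp [root, Ne.symm h.1]

theorem rootRep_wordProd_coweight_of_notMem {ω : List B} {k : B} (h : k ∉ ω) :
    cs.rootRep (cs.wordProd ω) (coweight k) = coweight k := by
  induction ω with
  | nil => simp
  | cons i ω ih =>
    simp only [List.mem_cons, not_or] at h
    rw [rootRep_wordProd_cons_apply, ih h.2, rootRep_simple_apply,
      M.coroot_coweight_of_ne (Ne.symm h.1), zero_smul, sub_zero]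

/-- A letter occurring exactly once in a word occurs in every word with the same product. -/
theorem mem_of_wordProd_append_cons_eq {u v ω : List B} {k : B} (hu : k ∉ u) (hv : k ∉ v)
    (h : cs.wordProd (u ++ k :: v) = cs.wordProd ω) : k ∈ ω := by
  by_contra hω
  have h1 : (cs.rootRep (cs.wordProd (u ++ k :: v)) (coweight k)).1 k = -1 := by
    rw [wordProd_append, map_mul, LinearEquiv.mul_apply,
      cs.rootRep_wordProd_apply_fst_of_notMem hu, rootRep_wordProd_cons_apply,
      cs.rootRep_wordProd_coweight_of_notMem hv, rootRep_simple_apply, M.coroot_coweight_self]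
    simp [root, coweight]
  rw [h, cs.rootRep_wordProd_coweight_of_notMem hω] at h1
  norm_num [coweight] at h1

theorem subset_of_nodup_of_wordProd_eq {ω ω' : List B} (hω : ω.Nodup)
    (h : cs.wordProd ω = cs.wordProd ω') : ω ⊆ ω' := by
  intro k hk
  obtain ⟨u, v, rfl⟩ := List.append_of_mem hk
  rw [List.nodup_middle, List.nodup_cons, List.mem_append, not_or] at hω
  exact cs.mem_of_wordProd_append_cons_eq hω.1.1 hω.1.2 h

/-- A word with pairwise distinct letters is reduced. -/
theorem isReduced_of_nodup_s7 {ω : List B} (hω : ω.Nodup) : cs.IsReduced ω := by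
  obtain ⟨ω', hω', h⟩ := cs.exists_isReduced (cs.wordProd ω)
  refine le_antisymm (cs.length_wordProd_le ω) ?_
  rw [h, hω'.eq]
  exact (hω.subperm (cs.subset_of_nodup_of_wordProd_eq hω h)).length_le

theorem coroot_root_eq_zero_of_coroot_rootRep_eq {i : B} {v : List B} (hv : (i :: v).Nodup)
    (h : ∀ x, M.coroot i (cs.rootRep (cs.wordProd v) x) = M.coroot i x) :
    ∀ k ∈ v, M.coroot i (root k) = 0 := by
  induction v with
  | nil => simp
  | cons k v ih =>
    simp only [List.nodup_cons, List.mem_cons, not_or] at hv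
    obtain ⟨⟨hik, hiv⟩, hkv, hv⟩ := hv
    have hk : M.coroot i (root k) = 0 := by
      have := h (coweight k)
      rw [rootRep_wordProd_cons_apply, cs.rootRep_wordProd_coweight_of_notMem hkv,
        rootRep_simple_apply, M.coroot_coweight_self] at this
      simpa using this
    intro l hl
    obtain rfl | hl := List.mem_cons.1 hl
    · exact hk
    · refine ih (List.nodup_cons.2 ⟨hiv, hv⟩) (fun x ↦ ?_) l hl
      rw [← h x, rootRep_wordProd_cons_apply, rootRep_simple_apply]
      simp [hk]

theorem commute_simple_of_eq_two {i j : B} (h : M i j = 2) :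
    Commute (cs.simple i) (cs.simple j) := by
  have := cs.simple_mul_simple_pow i j
  rw [h, pow_two] at this
  have := eq_inv_of_mul_eq_one_left this
  rwa [mul_inv_rev, inv_simple, inv_simple] at this

/-- If a letter `i` of a word with distinct letters is a right descent of its product, then `i`
commutes with every later letter. -/
theorem commute_of_isRightDescent_wordProd {u v : List B} {i : B} (hω : (u ++ i :: v).Nodup)
    (h : cs.IsRightDescent (cs.wordProd (u ++ i :: v)) i) :
    ∀ k ∈ v, Commute (cs.simple i) (cs.simple k) := by
  obtain ⟨ω', hω', h'⟩ := cs.exists_isReduced (cs.wordProd (u ++ i :: v) * cs.simple i)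
  have hlen : ω'.length < (u ++ i :: v).length := by
    rw [← hω'.eq, ← h']
    exact h.trans_le (cs.length_wordProd_le _)
  rw [List.nodup_middle] at hω
  have hiuv := (List.nodup_cons.1 hω).1
  rw [List.mem_append, not_or] at hiuv
  have huv : (u ++ v).Nodup := (List.nodup_cons.1 hω).2
  have hiω' : i ∉ ω' := by
    intro hi
    refine hlen.not_ge ?_
    rw [List.perm_middle.length_eq]
    refine (hω.subperm fun k hk ↦ ?_).length_le
    by_cases hki : k = i
    · exact hki ▸ hi
    replace hk := (List.mem_cons.1 hk).resolve_left hki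
    obtain hk | hk := List.mem_append.1 hk
    · obtain ⟨u₁, u₂, rfl⟩ := List.append_of_mem hk
      rw [List.append_assoc, List.cons_append, List.nodup_middle, List.nodup_cons] at huv
      simp only [List.mem_append, not_or] at huv
      refine cs.mem_of_wordProd_append_cons_eq (u := u₁) (v := u₂ ++ i :: v ++ [i])
        huv.1.1 (by simp [huv.1.2, hki]) ?_
      simpa [wordProd_append, wordProd_cons, mul_assoc] using h'
    · obtain ⟨v₁, v₂, rfl⟩ := List.append_of_mem hk
      rw [← List.append_assoc, List.nodup_middle, List.nodup_cons] at huv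
      simp only [List.mem_append, not_or] at huv
      refine cs.mem_of_wordProd_append_cons_eq (u := u ++ i :: v₁) (v := v₂ ++ [i])
        (by simp [huv.1.1, hki]) (by simp [huv.1.2, hki]) ?_
      simpa [wordProd_append, wordProd_cons, mul_assoc] using h'
  intro k hk
  refine cs.commute_simple_of_eq_two (M.eq_two_of_coroot_root_eq_zero ?_ ?_)
  · rintro rfl
    exact hiuv.2 hk
  refine cs.coroot_root_eq_zero_of_coroot_rootRep_eq
    (hω.sublist ((List.sublist_append_right u v).cons_cons i)) (fun x ↦ ?_) k hk
  have h1 := cs.rootRep_wordProd_apply_fst_of_notMem hiω' (cs.rootRep (cs.simple i) x)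
  rw [← h', wordProd_append, mul_assoc, map_mul, LinearEquiv.mul_apply,
    cs.rootRep_wordProd_apply_fst_of_notMem hiuv.1, map_mul, LinearEquiv.mul_apply,
    ← LinearEquiv.mul_apply (cs.rootRep (cs.simple i)), ← map_mul, simple_mul_simple_self,
    map_one, LinearEquiv.coe_one, id_eq, rootRep_wordProd_cons_apply, rootRep_simple_apply,
    rootRep_simple_apply] at h1
  simpa [root, cs.rootRep_wordProd_apply_fst_of_notMem hiuv.2] using h1

theorem isRightDescent_wordProd_of_commute {u v : List B} {i : B} (hω : (u ++ i :: v).Nodup)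
    (h : ∀ k ∈ v, Commute (cs.simple i) (cs.simple k)) :
    cs.IsRightDescent (cs.wordProd (u ++ i :: v)) i := by
  have hcomm : Commute (cs.simple i) (cs.wordProd v) :=
    Commute.list_prod_right _ _ (by simpa using h)
  have heq : cs.wordProd (u ++ i :: v) * cs.simple i = cs.wordProd (u ++ v) := by
    rw [wordProd_append, wordProd_cons, hcomm.eq, wordProd_append, mul_assoc, mul_assoc,
      simple_mul_simple_self, mul_one]
  rw [IsRightDescent, heq, (cs.isReduced_of_nodup_s7 hω).eq]
  refine (cs.length_wordProd_le _).trans_lt ?_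
  simp

theorem mem_of_isRightDescent_wordProd {ω : List B} {i : B} (hω : ω.Nodup)
    (h : cs.IsRightDescent (cs.wordProd ω) i) : i ∈ ω := by
  by_contra hi
  have h1 : (ω ++ [i]).Nodup := by
    rw [← List.concat_eq_append]
    exact hω.concat hi
  have h2 := (cs.isReduced_of_nodup_s7 h1).eq
  rw [IsRightDescent, (cs.isReduced_of_nodup_s7 hω).eq] at h
  rw [wordProd_append, wordProd_singleton, List.length_append] at h2
  omega

theorem subwordProd_mem_minCosetReps_iff (SP : Set B) {ω : List B} (hω : ω.Nodup)
    (A : Finset (Fin ω.length)) :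
    cs.subwordProd ω A ∈ cs.minCosetReps SP ↔
      ∀ j ∈ A, ω.get j ∈ SP →
        ∃ k ∈ A, j < k ∧ ¬ Commute (cs.simple (ω.get j)) (cs.simple (ω.get k)) := by
  have hnodup : ((A.sort (· ≤ ·)).map ω.get).Nodup :=
    (A.sort_nodup _).map (List.nodup_iff_injective_get.1 hω)
  have hmem : cs.subwordProd ω A ∈ cs.minCosetReps SP ↔
      ∀ i ∈ SP, ¬ cs.IsRightDescent (cs.subwordProd ω A) i :=
    forall₂_congr fun i _ ↦
      ⟨fun h ↦ h.not_gt, fun h ↦ (not_lt.1 h).lt_of_ne (cs.length_mul_simple_ne _ _).symm⟩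
  have hsplit {j : Fin ω.length} {l₁ l₂ : List (Fin ω.length)}
      (hl : A.sort (· ≤ ·) = l₁ ++ j :: l₂) (k : Fin ω.length) : k ∈ l₂ ↔ k ∈ A ∧ j < k := by
    have hs := A.sortedLT_sort.pairwise
    rw [← A.mem_sort (· ≤ ·)]
    rw [hl] at hs ⊢
    simp only [List.pairwise_append, List.pairwise_cons, List.mem_cons] at hs
    simp only [List.mem_append, List.mem_cons]
    grind
  rw [hmem]
  constructor
  · intro h j hj hjP
    obtain ⟨l₁, l₂, hl⟩ := List.append_of_mem ((A.mem_sort (· ≤ ·)).2 hj)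
    by_contra! hc
    refine h _ hjP ?_
    rw [hl, List.map_append, List.map_cons] at hnodup
    rw [subwordProd, hl, List.map_append, List.map_cons]
    refine cs.isRightDescent_wordProd_of_commute hnodup fun b hb ↦ ?_
    obtain ⟨k, hk, rfl⟩ := List.mem_map.1 hb
    obtain ⟨hkA, hjk⟩ := (hsplit hl k).1 hk
    exact hc k hkA hjk
  · intro h i hi hdesc
    obtain ⟨j, hj, rfl⟩ := List.mem_map.1 (cs.mem_of_isRightDescent_wordProd hnodup hdesc)
    obtain ⟨l₁, l₂, hl⟩ := List.append_of_mem hj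
    obtain ⟨k, hkA, hjk, hk⟩ := h j ((A.mem_sort (· ≤ ·)).1 hj) hi
    rw [subwordProd, hl, List.map_append, List.map_cons] at hdesc
    rw [hl, List.map_append, List.map_cons] at hnodup
    exact hk (cs.commute_of_isRightDescent_wordProd hnodup hdesc _
      (List.mem_map_of_mem ((hsplit hl k).2 ⟨hkA, hjk⟩)))

end CoxeterSystem

/-- Let `w = s_{i_1} ⋯ s_{i_r}` be a reduced expression with pairwise distinct
simple reflections, `S_P ⊆ S`, and let `F = {A ⊆ {1,…,r} : w_A ∈ W^P}` be the family of
feasible sets. Then `∅ ∈ F`, and for all `A, B ∈ F` with `B ⊄ A`, if `x` is the largest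
element of `B \ A` then `A ∪ {x} ∈ F`: the ground set with the reversed total order together
with `F` is a supersolvable antimatroid in the sense of Armstrong. -/
theorem feasible_sets_supersolvable_antimatroid {B W : Type*} [Group W] {M : CoxeterMatrix B}
    (cs : CoxeterSystem M W) (SP : Set B) (ω : List B) (hred : cs.IsReduced ω)
    (hdist : (ω.map cs.simple).Nodup) :
    cs.subwordProd ω (∅ : Finset (Fin ω.length)) ∈ cs.minCosetReps SP ∧
    ∀ A Bs : Finset (Fin ω.length),
      cs.subwordProd ω A ∈ cs.minCosetReps SP →
      cs.subwordProd ω Bs ∈ cs.minCosetReps SP →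
      ¬ Bs ⊆ A →
      ∀ hne : (Bs \ A).Nonempty,
        cs.subwordProd ω (insert ((Bs \ A).max' hne) A) ∈ cs.minCosetReps SP := by
  have hω : ω.Nodup := hdist.of_map
  simp only [cs.subwordProd_mem_minCosetReps_iff SP hω]
  refine ⟨by simp, fun A Bs hA hB _ hne j hj hjP ↦ ?_⟩
  obtain rfl | hjA := Finset.mem_insert.1 hj
  · obtain ⟨k, hkB, hjk, hk⟩ := hB _ (Finset.mem_sdiff.1 (Finset.max'_mem _ hne)).1 hjP
    refine ⟨k, Finset.mem_insert_of_mem ?_, hjk, hk⟩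
    by_contra hkA
    exact hjk.not_ge (Finset.le_max' _ _ (Finset.mem_sdiff.2 ⟨hkB, hkA⟩))
  · obtain ⟨k, hkA, hjk, hk⟩ := hA j hjA hjP
    exact ⟨k, Finset.mem_insert_of_mem hkA, hjk, hk⟩
end
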